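/- arXiv:1901.03744 — 3 statements merged into one kernel-verified Lean document; each statement's English description precedes it below -/
import Mathlib

section
/- Fix a graph G = (V, E) and an injective priority assignment ρ : E → [0,1]. If G' is the graph obtained from G by removing a single vertex (together with its incident edges), then there are at most 2 vertices whose match-status differs between GreedyMM(G, ρ) and GreedyMM(G', ρ). -/
open Finset
open scoped Classical

section Defs

private lemma sym2_exists_mem {V : Type*} (e : Sym2 V) : ∃ a, a ∈ e :=
  ⟨(Quot.out e).1, Sym2.out_fst_mem e⟩

variable {V : Type*} [Fintype V] [DecidableEq V]

/-- The greedy maximal matching of the graph with edge set `E`, processing edges in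
increasing order of the priority function `ρ`: repeatedly pick the minimum-priority
remaining edge, add it to the matching, and discard all edges meeting it. -/
noncomputable def greedyMM {β : Type*} [LinearOrder β] (ρ : Sym2 V → β) (E : Finset (Sym2 V)) :
    Finset (Sym2 V) :=
  if h : E.Nonempty then
    insert (Classical.choose (E.exists_min_image ρ h))
      (greedyMM ρ (E.filter fun f =>
        ¬ ∃ v, v ∈ Classical.choose (E.exists_min_image ρ h) ∧ v ∈ f))
  else ∅
termination_by E.card
decreasing_by
  have he : Classical.choose (E.exists_min_image ρ h) ∈ E :=
    (Classical.choose_spec (E.exists_min_image ρ h)).1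
  apply Finset.card_lt_card
  refine (Finset.ssubset_iff_of_subset (Finset.filter_subset _ _)).2 ⟨_, he, ?_⟩
  intro hmem
  obtain ⟨a, ha⟩ := sym2_exists_mem (Classical.choose (E.exists_min_image ρ h))
  exact (Finset.mem_filter.1 hmem).2 ⟨a, ha, ha⟩

/-- The set of vertices matched by a set `M` of edges. -/
noncomputable def matchedV (M : Finset (Sym2 V)) : Finset V :=
  Finset.univ.filter fun v => ∃ e ∈ M, v ∈ e

/-- Residual degree of `v` with respect to the matching `M` in the graph with edge set `E`:
`0` if `v` is matched, and otherwise the degree of `v` in the induced subgraph on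
unmatched vertices. -/
noncomputable def resDeg (E M : Finset (Sym2 V)) (v : V) : ℕ :=
  if v ∈ matchedV M then 0
  else (E.filter fun e => v ∈ e ∧ ∀ w ∈ e, w ∉ matchedV M).card

/-- The number of vertices whose match-status differs between `M` and `M'`. -/
noncomputable def statusDiff (M M' : Finset (Sym2 V)) : ℕ :=
  (Finset.univ.filter fun v => ¬ (v ∈ matchedV M ↔ v ∈ matchedV M')).card

end Defs

theorem greedyMM_eq_insert {V β : Type*} [Fintype V] [DecidableEq V] [LinearOrder β]
    {ρ : Sym2 V → β} {E : Finset (Sym2 V)} (hρ : Set.InjOn ρ ↑E) {e : Sym2 V} (he : e ∈ E)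
    (hmin : ∀ f ∈ E, ρ e ≤ ρ f) :
    greedyMM ρ E = insert e (greedyMM ρ (E.filter fun f => ¬ ∃ v, v ∈ e ∧ v ∈ f)) := by
  have hne : E.Nonempty := ⟨e, he⟩
  obtain ⟨hmem, hle⟩ := Classical.choose_spec (E.exists_min_image ρ hne)
  have hchoose : Classical.choose (E.exists_min_image ρ hne) = e :=
    hρ hmem he (le_antisymm (hle e he) (hmin _ hmem))
  rw [greedyMM, dif_pos hne, hchoose]

theorem mem_matchedV_insert {V : Type*} [Fintype V] [DecidableEq V] {e : Sym2 V}
    {M : Finset (Sym2 V)} {x : V} : x ∈ matchedV (insert e M) ↔ x ∈ e ∨ x ∈ matchedV M := by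
  simp [matchedV]

/-- Removing `v` changes the match-status of no vertex if `v` is unmatched, and otherwise of at
most one vertex besides `v`. -/
theorem greedyMM_remove_vertex {V β : Type*} [Fintype V] [DecidableEq V] [LinearOrder β]
    (ρ : Sym2 V → β) (E : Finset (Sym2 V)) (hρ : Set.InjOn ρ ↑E) (v : V) :
    (v ∉ matchedV (greedyMM ρ E) → ∀ x, x ∈ matchedV (greedyMM ρ E) ↔
        x ∈ matchedV (greedyMM ρ (E.filter fun e => v ∉ e))) ∧
      ∃ w, ∀ x, x ≠ v → x ≠ w → (x ∈ matchedV (greedyMM ρ E) ↔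
        x ∈ matchedV (greedyMM ρ (E.filter fun e => v ∉ e))) := by
  induction E using Finset.strongInduction generalizing v with
  | H E ih =>
  rcases E.eq_empty_or_nonempty with rfl | hne
  · exact ⟨by simp, v, by simp⟩
  obtain ⟨e, he, hmin⟩ := E.exists_min_image ρ hne
  have hsub (p : Sym2 V → Prop) [DecidablePred p] : Set.InjOn ρ ↑(E.filter p) :=
    hρ.mono (Finset.coe_subset.2 (Finset.filter_subset _ _))
  have hss (p : Sym2 V → Prop) [DecidablePred p] (hp : ¬ p e) : E.filter p ⊂ E :=
    Finset.filter_ssubset.2 ⟨e, he, hp⟩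
  have hEe := greedyMM_eq_insert hρ he hmin
  by_cases hv : v ∈ e
  · obtain ⟨u, rfl⟩ := hv
    have hE : (E.filter fun f => ¬ ∃ x, x ∈ s(v, u) ∧ x ∈ f) =
        (E.filter fun f => v ∉ f).filter fun f => u ∉ f := by
      ext f
      simp [and_assoc]
    rw [hE] at hEe
    obtain ⟨hsame, w, hw⟩ := ih (E.filter fun f => v ∉ f) (hss (fun f => v ∉ f) (by simp))
      (hsub fun f => v ∉ f) u
    have hmem (x : V) : x ∈ matchedV (greedyMM ρ E) ↔ (x = v ∨ x = u) ∨
        x ∈ matchedV (greedyMM ρ ((E.filter fun f => v ∉ f).filter fun f => u ∉ f)) := by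
      rw [hEe, mem_matchedV_insert, Sym2.mem_iff]
    refine ⟨fun h => absurd ((hmem v).2 (.inl (.inl rfl))) h, ?_⟩
    by_cases hu : u ∈ matchedV (greedyMM ρ (E.filter fun f => v ∉ f))
    · refine ⟨w, fun x hxv hxw => ?_⟩
      rw [hmem]
      by_cases hxu : x = u
      · simp [hxu, hu]
      · simp [hxv, hxu, hw x hxu hxw]
    · refine ⟨u, fun x hxv hxu => ?_⟩
      simp [hmem, hxv, hxu, hsame hu x]
  · have hEe' := greedyMM_eq_insert (hsub fun f => v ∉ f)
      (Finset.mem_filter.2 ⟨he, hv⟩) (fun f hf => hmin f (Finset.mem_filter.1 hf).1)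
    rw [Finset.filter_comm] at hEe'
    have hlt : (E.filter fun f => ¬ ∃ x, x ∈ e ∧ x ∈ f) ⊂ E :=
      hss _ fun h => h ⟨_, e.out_fst_mem, e.out_fst_mem⟩
    obtain ⟨hsame, w, hw⟩ := ih _ hlt (hsub _) v
    rw [hEe, hEe']
    simp only [mem_matchedV_insert]
    refine ⟨fun h x => ?_, w, fun x hxv hxw => ?_⟩
    · rw [hsame (fun h' => h (.inr h')) x]
    · rw [hw x hxv hxw]

/-- **Stability of greedy matching under vertex removal** (Lemma A.2, part 1).
Fix a graph `G = (V, E)` and an injective priority assignment `ρ : E → [0,1]`.  If `G'`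
is obtained from `G` by removing a single vertex `v₀` (together with its incident edges),
then there are at most `2` vertices whose match-status differs between
`GreedyMM(G, ρ)` and `GreedyMM(G', ρ)`. -/
theorem greedy_matching_vertex_removal_stability
    {V : Type*} [Fintype V] [DecidableEq V]
    (E : Finset (Sym2 V)) (hE : ∀ e ∈ E, ¬ e.IsDiag)
    (ρ : Sym2 V → ℝ) (hρ01 : ∀ e ∈ E, ρ e ∈ Set.Icc (0 : ℝ) 1) (hρ : Set.InjOn ρ ↑E)
    (v₀ : V) :
    statusDiff (greedyMM ρ E) (greedyMM ρ (E.filter fun e => v₀ ∉ e)) ≤ 2 := by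
  obtain ⟨-, w, hw⟩ := greedyMM_remove_vertex ρ E hρ v₀
  refine (Finset.card_le_card (t := {v₀, w}) fun x hx => ?_).trans Finset.card_le_two
  by_contra hxw
  simp only [Finset.mem_insert, Finset.mem_singleton, not_or] at hxw
  exact (Finset.mem_filter.1 hx).2 (hw x hxw.1 hxw.2)
end

section
/- Fix a graph G = (V, E) and an injective priority assignment ρ : E → [0,1]. If G' is the graph obtained from G by removing a single edge, then there are at most 2 vertices whose match-status differs between GreedyMM(G, ρ) and GreedyMM(G', ρ). -/
open Finset
open scoped Classical

section GreedyStability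

/-- If `U` differs from `S` only at `a`, `b`, with no change unless `a ∈ S`, and `T` differs
from `U` only at `c`, `d`, with no change unless `c ∈ U`, then `insert a (insert c T)` differs
from `S` in at most two points. -/
theorem exists_pair_of_successive_changes {V : Type*} {S U T : Finset V} {a b c d : V}
    (haU : a ∉ U)
    (hb : ∀ v, ¬ (v ∈ S ↔ v ∈ U) → a ∈ S ∧ (v = a ∨ v = b))
    (hd : ∀ v, ¬ (v ∈ U ↔ v ∈ T) → c ∈ U ∧ (v = c ∨ v = d)) :
    ∃ x y, ∀ v, ¬ (v = a ∨ v = c ∨ v ∈ T ↔ v ∈ S) → v = x ∨ v = y := by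
  have split : ∀ x y, (∀ v, v ≠ a → v ≠ c → ¬ (v ∈ T ↔ v ∈ S) → v = x ∨ v = y) →
      (a ∉ S → a = x ∨ a = y) → (c ∉ S → c = x ∨ c = y) →
      ∃ x y, ∀ v, ¬ (v = a ∨ v = c ∨ v ∈ T ↔ v ∈ S) → v = x ∨ v = y := by
    refine fun x y h ha hc => ⟨x, y, fun v hv => ?_⟩
    by_cases hva : v = a
    · grind
    by_cases hvc : v = c
    · grind
    exact h v hva hvc (by simpa [hva, hvc] using hv)
  by_cases haS : a ∈ S <;> by_cases hcS : c ∈ S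
  · exact split b d (by grind) (by grind) (by grind)
  · by_cases hcU : c ∈ U
    · refine split c d (fun v hva hvc hv => ?_) (by grind) (by grind)
      have hbc := hb c
      have hbv := hb v
      have hdv := hd v
      by_cases v ∈ U <;> grind
    · exact split b c (by grind) (by grind) (by grind)
  · exact split a d (by grind) (by grind) (by grind)
  · exact split a c (by grind) (by grind) (by grind)

variable {V : Type*} [Fintype V] [DecidableEq V]

theorem mem_matchedV {M : Finset (Sym2 V)} {v : V} :
    v ∈ matchedV M ↔ ∃ e ∈ M, v ∈ e := by
  simp [matchedV]

theorem mem_of_mem_greedyMM {β : Type*} [LinearOrder β] (ρ : Sym2 V → β)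
    (E : Finset (Sym2 V)) {e : Sym2 V} (he : e ∈ greedyMM ρ E) : e ∈ E := by
  induction hn : E.card using Nat.strong_induction_on generalizing E with
  | _ n ih =>
    rw [greedyMM] at he
    split_ifs at he with h
    · have hc := (Classical.choose_spec (E.exists_min_image ρ h)).1
      rcases Finset.mem_insert.1 he with rfl | he
      · exact hc
      · refine (Finset.mem_filter.1 (ih _ ?_ _ he rfl)).1
        rw [← hn]
        refine Finset.card_lt_card
          ((Finset.ssubset_iff_of_subset (Finset.filter_subset _ _)).2 ⟨_, hc, fun hmem => ?_⟩)
        exact (Finset.mem_filter.1 hmem).2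
          ⟨_, Sym2.out_fst_mem _, Sym2.out_fst_mem _⟩
    · simp at he

theorem notMem_matchedV_greedyMM {β : Type*} [LinearOrder β] (ρ : Sym2 V → β)
    {E : Finset (Sym2 V)} {v : V} (hv : ∀ e ∈ E, v ∉ e) : v ∉ matchedV (greedyMM ρ E) := by
  rw [mem_matchedV]
  rintro ⟨e, he, hve⟩
  exact hv e (mem_of_mem_greedyMM ρ E he) hve

/-- Unfolding the greedy matching at the edge of minimum priority. -/
theorem mem_matchedV_greedyMM_iff {β : Type*} [LinearOrder β] {ρ : Sym2 V → β}
    {E F : Finset (Sym2 V)} (hρ : Set.InjOn ρ ↑E) {e : Sym2 V} (he : e ∈ E)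
    (hmin : ∀ f ∈ E, ρ e ≤ ρ f) (hF : ∀ f, f ∈ F ↔ f ∈ E ∧ ∀ v ∈ e, v ∉ f) (v : V) :
    v ∈ matchedV (greedyMM ρ E) ↔ v ∈ e ∨ v ∈ matchedV (greedyMM ρ F) := by
  have h : E.Nonempty := ⟨e, he⟩
  have hc := Classical.choose_spec (E.exists_min_image ρ h)
  have hce : Classical.choose (E.exists_min_image ρ h) = e :=
    hρ hc.1 he (le_antisymm (hc.2 e he) (hmin _ hc.1))
  have hfil : (E.filter fun f =>
      ¬ ∃ v, v ∈ Classical.choose (E.exists_min_image ρ h) ∧ v ∈ f) = F := by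
    ext f
    rw [Finset.mem_filter, hF, hce]
    simp
  rw [greedyMM, dif_pos h, hfil, hce]
  simp [mem_matchedV]

/-- Deleting the vertex `a` changes the match-status of `a` and at most one further vertex,
and changes nothing when `a` is unmatched. -/
theorem exists_matchedV_greedyMM_vertex_removal {β : Type*} [LinearOrder β] {ρ : Sym2 V → β}
    (a : V) {E F : Finset (Sym2 V)} (hρ : Set.InjOn ρ ↑E)
    (hF : ∀ f, f ∈ F ↔ f ∈ E ∧ a ∉ f) :
    ∃ b, ∀ v, ¬ (v ∈ matchedV (greedyMM ρ E) ↔ v ∈ matchedV (greedyMM ρ F)) →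
      a ∈ matchedV (greedyMM ρ E) ∧ (v = a ∨ v = b) := by
  induction hn : E.card using Nat.strong_induction_on generalizing E F a with
  | _ n ih =>
    rcases E.eq_empty_or_nonempty with rfl | h
    · have : F = ∅ := by ext f; simp [hF]
      subst this
      exact ⟨a, fun v hv => absurd Iff.rfl hv⟩
    obtain ⟨e, he, hmin⟩ := E.exists_min_image ρ h
    have hFE : F ⊆ E := fun f hf => ((hF f).1 hf).1
    have hlt : ∀ {K : Finset (Sym2 V)}, K ⊆ E → e ∉ K → K.card < n := fun hK heK => by
      rw [← hn]
      exact Finset.card_lt_card ((Finset.ssubset_iff_of_subset hK).2 ⟨e, he, heK⟩)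
    have hE' : ∀ f, f ∈ E.filter (fun f => ∀ v ∈ e, v ∉ f) ↔ f ∈ E ∧ ∀ v ∈ e, v ∉ f := by
      simp
    by_cases hae : a ∈ e
    · obtain ⟨c, rfl⟩ := hae
      have hK : ∀ f, f ∈ E.filter (fun f => ∀ v ∈ s(a, c), v ∉ f) ↔ f ∈ F ∧ c ∉ f := by
        intro f
        rw [hE', hF]
        simp [and_assoc]
      obtain ⟨b, hb⟩ := ih _ (hlt hFE (by simp [hF])) c (hρ.mono hFE) hK rfl
      have hstep := mem_matchedV_greedyMM_iff hρ he hmin hE'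
      have hc := notMem_matchedV_greedyMM ρ (v := c) fun f hf => ((hK f).1 hf).2
      have ha := (hstep a).2 (Or.inl (Sym2.mem_mk_left a c))
      by_cases hcF : c ∈ matchedV (greedyMM ρ F)
      · refine ⟨b, fun v hv => ⟨ha, ?_⟩⟩
        rw [hstep, Sym2.mem_iff] at hv
        have := hb v
        grind
      · refine ⟨c, fun v hv => ⟨ha, ?_⟩⟩
        rw [hstep, Sym2.mem_iff] at hv
        have := hb v
        grind
    · have heF : e ∈ F := (hF e).2 ⟨he, hae⟩
      have hF' : ∀ f, f ∈ F.filter (fun f => ∀ v ∈ e, v ∉ f) ↔ f ∈ F ∧ ∀ v ∈ e, v ∉ f := by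
        simp
      obtain ⟨b, hb⟩ := ih _
        (hlt (Finset.filter_subset (fun f => ∀ v ∈ e, v ∉ f) E) fun hmem =>
          ((hE' e).1 hmem).2 _ (Sym2.out_fst_mem e) (Sym2.out_fst_mem e)) a
        (F := F.filter (fun f => ∀ v ∈ e, v ∉ f))
        (hρ.mono (Finset.filter_subset _ _))
        (fun f => by rw [hE', hF', hF]; tauto) rfl
      refine ⟨b, fun v hv => ?_⟩
      rw [mem_matchedV_greedyMM_iff hρ he hmin hE',
        mem_matchedV_greedyMM_iff (hρ.mono hFE) heF (fun f hf => hmin f (hFE hf)) hF'] at hv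
      rw [mem_matchedV_greedyMM_iff hρ he hmin hE']
      have := hb v
      tauto

/-- Deleting one edge changes the match-status of at most two vertices. -/
theorem exists_matchedV_greedyMM_edge_removal {β : Type*} [LinearOrder β] {ρ : Sym2 V → β}
    (e₀ : Sym2 V) {E F : Finset (Sym2 V)} (hρ : Set.InjOn ρ ↑E)
    (hF : ∀ f, f ∈ F ↔ f ∈ E ∧ f ≠ e₀) :
    ∃ b d, ∀ v, ¬ (v ∈ matchedV (greedyMM ρ E) ↔ v ∈ matchedV (greedyMM ρ F)) →
      v = b ∨ v = d := by
  induction hn : E.card using Nat.strong_induction_on generalizing E F with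
  | _ n ih =>
    rcases E.eq_empty_or_nonempty with rfl | h
    · have : F = ∅ := by ext f; simp [hF]
      subst this
      exact ⟨e₀.out.1, e₀.out.1, fun v hv => absurd Iff.rfl hv⟩
    obtain ⟨e, he, hmin⟩ := E.exists_min_image ρ h
    have hFE : F ⊆ E := fun f hf => ((hF f).1 hf).1
    have hE' : ∀ f, f ∈ E.filter (fun f => ∀ v ∈ e, v ∉ f) ↔ f ∈ E ∧ ∀ v ∈ e, v ∉ f := by
      simp
    have heE' : e ∉ E.filter (fun f => ∀ v ∈ e, v ∉ f) := fun hmem =>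
      ((hE' e).1 hmem).2 _ (Sym2.out_fst_mem e) (Sym2.out_fst_mem e)
    have hstep := mem_matchedV_greedyMM_iff hρ he hmin hE'
    by_cases hee : e = e₀
    · subst hee
      obtain ⟨a, c, rfl⟩ : ∃ a c, e = s(a, c) := by
        induction e with | _ a c => exact ⟨a, c, rfl⟩
      have hU : ∀ f, f ∈ F.filter (fun f => a ∉ f) ↔ f ∈ F ∧ a ∉ f := by simp
      have hT : ∀ f, f ∈ E.filter (fun f => ∀ v ∈ s(a, c), v ∉ f) ↔
          f ∈ F.filter (fun f => a ∉ f) ∧ c ∉ f := by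
        intro f
        rw [hE', hU, hF]
        have : f = s(a, c) → a ∈ f := by rintro rfl; simp
        simp only [Sym2.mem_iff, forall_eq_or_imp, forall_eq]
        tauto
      have hρF := hρ.mono (Finset.coe_subset.2 hFE)
      obtain ⟨b, hb⟩ := exists_matchedV_greedyMM_vertex_removal a hρF hU
      obtain ⟨d, hd⟩ := exists_matchedV_greedyMM_vertex_removal c
        (hρF.mono (Finset.filter_subset _ _)) hT
      obtain ⟨x, y, hxy⟩ := exists_pair_of_successive_changes
        (notMem_matchedV_greedyMM ρ fun f hf => ((hU f).1 hf).2) hb hd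
      exact ⟨x, y, fun v hv => hxy v (by rwa [hstep, Sym2.mem_iff, or_assoc] at hv)⟩
    · have heF : e ∈ F := (hF e).2 ⟨he, hee⟩
      have hF' : ∀ f, f ∈ F.filter (fun f => ∀ v ∈ e, v ∉ f) ↔ f ∈ F ∧ ∀ v ∈ e, v ∉ f := by
        simp
      obtain ⟨b, d, hbd⟩ := ih _
        (hn ▸ Finset.card_lt_card
          ((Finset.ssubset_iff_of_subset (Finset.filter_subset _ _)).2 ⟨e, he, heE'⟩))
        (F := F.filter (fun f => ∀ v ∈ e, v ∉ f))
        (hρ.mono (Finset.filter_subset _ _))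
        (fun f => by rw [hE', hF', hF]; tauto) rfl
      refine ⟨b, d, fun v hv => hbd v fun hiff => hv ?_⟩
      rw [hstep, mem_matchedV_greedyMM_iff (hρ.mono hFE) heF (fun f hf => hmin f (hFE hf)) hF',
        hiff]

end GreedyStability

/-- **Stability of greedy matching under edge removal** (Lemma A.2, part 2).
Fix a graph `G = (V, E)` and an injective priority assignment `ρ : E → [0,1]`.  If `G'`
is obtained from `G` by removing a single edge `e₀`, then there are at most `2` vertices
whose match-status differs between `GreedyMM(G, ρ)` and `GreedyMM(G', ρ)`. -/
theorem greedy_matching_edge_removal_stability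
    {V : Type*} [Fintype V] [DecidableEq V]
    (E : Finset (Sym2 V)) (hE : ∀ e ∈ E, ¬ e.IsDiag)
    (ρ : Sym2 V → ℝ) (hρ01 : ∀ e ∈ E, ρ e ∈ Set.Icc (0 : ℝ) 1) (hρ : Set.InjOn ρ ↑E)
    (e₀ : Sym2 V) (he₀ : e₀ ∈ E) :
    statusDiff (greedyMM ρ E) (greedyMM ρ (E.erase e₀)) ≤ 2 := by
  obtain ⟨b, d, hbd⟩ := exists_matchedV_greedyMM_edge_removal e₀ hρ
    (F := E.erase e₀) fun f => by rw [Finset.mem_erase, and_comm]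
  refine (Finset.card_le_card (t := {b, d}) fun v hv => ?_).trans Finset.card_le_two
  simpa using hbd v (Finset.mem_filter.1 hv).2
end

section
/- Consider Algorithm 1 run on an n-vertex graph G with m edges and maximum degree Δ. Then E[ Σ_{e ∈ L_1} A(e) ] ≤ C·n for a universal constant C, where the expectation is over the permutation π, the edge sample L, and the vertex partition χ, L_1 is the set of edges of L with both endpoints in V_1, and A(e) is the number of edges of L_1 on which EdgeOracle_π is recursively called during the execution of EdgeOracle_π(e, x⃗). -/
open Finset
open scoped Classical

section Defs

variable {V : Type*} [Fintype V] [DecidableEq V]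

/-- The endpoints of an edge, as a finset. -/
noncomputable def ends (e : Sym2 V) : Finset V := Finset.univ.filter (· ∈ e)

/-- The recursive edge oracle (with bookkeeping), for the graph with (sampled) edge set `L`
and priorities `π`, run with the partition-indicator vector `x`.
`eoQ π L x fuel e` returns a triple `(ans, qs, cnt)` where `ans` tells whether `e` joins the
greedy matching of the induced subgraph of `L` on `{v | x v}`, `qs` is the set of entries of
`x` queried, and `cnt` is the number of (recursive) oracle calls made on edges of `L` having
both endpoints in `{v | x v}` (including the call on `e` itself, when applicable).
The oracle first queries the two endpoints of `e` and answers NO if one of them is outside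
the part; otherwise it recursively evaluates the incident edges of `L` of smaller priority,
in increasing order of priority, stopping as soon as one of them answers YES.
It is always invoked with `fuel = π e + 1`, which guarantees the fuel never runs out. -/
noncomputable def eoQ (π : Sym2 V → ℕ) (L : Finset (Sym2 V)) (x : V → Bool) :
    ℕ → Sym2 V → Bool × Finset V × ℕ
  | 0, e => (false, ends e, 0)
  | fuel + 1, e =>
    if ∀ v ∈ e, x v then
      let nbrs := ((L.filter fun f => f ≠ e ∧ (∃ v, v ∈ e ∧ v ∈ f) ∧ π f < π e).toList.mergeSort
          (fun a b => decide (π a ≤ π b)))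
      let r := nbrs.foldl (fun (s : Bool × Finset V × ℕ) f =>
          if s.1 then s
          else
            let t := eoQ π L x fuel f
            (t.1, s.2.1 ∪ t.2.1, s.2.2 + t.2.2)) (false, ∅, 0)
      (!r.1, ends e ∪ r.2.1, (if e ∈ L then 1 else 0) + r.2.2)
    else (false, ends e, 0)

/-- Whether `e` belongs to the greedy matching, as decided by the edge oracle. -/
noncomputable def edgeOracle (π : Sym2 V → ℕ) (L : Finset (Sym2 V)) (x : V → Bool)
    (e : Sym2 V) : Bool × Finset V × ℕ :=
  eoQ π L x (π e + 1) e

/-- The degree oracle for vertex `v`: determines `Z_{v,1}`, the number of neighbors of `v`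
(in the graph with edge set `Ed`) lying in the part `{u | x u}` that are unmatched in the
greedy matching of the induced subgraph of `L`.  For each neighbor `u` of `v` it queries
`x u`, and if `x u = 1`, it runs the edge oracle on every edge of `L` incident to `u`.
Returns `(Z value, set of entries of x queried, number of oracle calls on edges inside the part)`. -/
noncomputable def degOr (Ed : Finset (Sym2 V)) (π : Sym2 V → ℕ) (L : Finset (Sym2 V))
    (x : V → Bool) (v : V) : ℕ × Finset V × ℕ :=
  let Nv := Finset.univ.filter fun u => s(u, v) ∈ Ed
  let q := Nv ∪ (Nv.filter fun u => x u).biUnion fun u =>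
      (Finset.univ.filter fun w => s(u, w) ∈ L).biUnion fun w =>
        (edgeOracle π L x s(u, w)).2.1
  let c := ∑ u ∈ Nv.filter (fun u => x u), ∑ w ∈ Finset.univ.filter (fun w => s(u, w) ∈ L),
        (edgeOracle π L x s(u, w)).2.2
  ((Nv.filter fun u => x u ∧ ∀ w ∈ Finset.univ.filter (fun w => s(u, w) ∈ L),
      (edgeOracle π L x s(u, w)).1 = false).card, q, c)

/-- `B v`: the number of entries of `x` queried during the execution of the degree oracle. -/
noncomputable def Bqueries (Ed : Finset (Sym2 V)) (π : Sym2 V → ℕ) (L : Finset (Sym2 V))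
    (x : V → Bool) (v : V) : ℕ :=
  (degOr Ed π L x v).2.1.card

/-- The priority function on edges induced by a permutation `τ` of `Fin E.card`,
via the canonical enumeration of `E`; edges outside `E` get priority `0`. -/
noncomputable def prioOf (E : Finset (Sym2 V)) (τ : Equiv.Perm (Fin E.card)) (e : Sym2 V) : ℕ :=
  if h : e ∈ E then (τ (E.equivFin ⟨e, h⟩) : ℕ) else 0

/-- `L₁`: the set of edges of `L` with both endpoints inside the part `{v | x v}`. -/
noncomputable def partEdges (L : Finset (Sym2 V)) (x : V → Bool) : Finset (Sym2 V) :=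
  L.filter fun e => ∀ v ∈ e, x v

/-- `Z_{v,1}(x)`: the number of neighbors of `v` in the graph `Ed` lying in the part
`{u | x u}` that are unmatched in `M₁ = GreedyMM(L₁, π)`. -/
noncomputable def Zv1 (Ed : Finset (Sym2 V)) (π : Sym2 V → ℕ) (L : Finset (Sym2 V))
    (x : V → Bool) (v : V) : ℕ :=
  (Finset.univ.filter fun u =>
    s(u, v) ∈ Ed ∧ x u ∧ u ∉ matchedV (greedyMM π (partEdges L x))).card


/-- The matching output by Algorithm 1: the union over all parts `i ∈ [k]` of the greedy
maximal matching (w.r.t. the priorities `π`) of the induced subgraph of the sampled edge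
set `L` on the part `V_i = χ⁻¹(i)`. -/
noncomputable def algoMatching (π : Sym2 V → ℕ) (k : ℕ) (χ : V → Fin k)
    (L : Finset (Sym2 V)) : Finset (Sym2 V) :=
  (Finset.univ : Finset (Fin k)).biUnion fun i =>
    greedyMM π (L.filter fun e => ∀ w ∈ e, χ w = i)

/-- `Z_{v,i}`: the number of neighbors of `v` in the graph `Ed` that lie in part `V_i`
and are unmatched in the matching `M` output by Algorithm 1. -/
noncomputable def Zvi (Ed : Finset (Sym2 V)) (π : Sym2 V → ℕ) (k : ℕ) (χ : V → Fin k)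
    (L : Finset (Sym2 V)) (v : V) (i : Fin k) : ℕ :=
  (Finset.univ.filter fun u =>
    s(u, v) ∈ Ed ∧ χ u = i ∧ u ∉ matchedV (algoMatching π k χ L)).card

/-- `Z'_v`: equal to `Z_{v, χ(v)}` if `v` is unmatched in the output `M` of Algorithm 1,
and `0` if `v` is matched in `M`. -/
noncomputable def Zself (Ed : Finset (Sym2 V)) (π : Sym2 V → ℕ) (k : ℕ) (χ : V → Fin k)
    (L : Finset (Sym2 V)) (v : V) : ℕ :=
  if v ∈ matchedV (algoMatching π k χ L) then 0 else Zvi Ed π k χ L v (χ v)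

/-- The Bernoulli product weight of the edge sample `S ⊆ Ed`, each edge kept with
probability `p`. -/
noncomputable def bwE (p : ℝ) (Ed S : Finset (Sym2 V)) : ℝ :=
  p ^ S.card * (1 - p) ^ (Ed.card - S.card)

/-- The Bernoulli product weight of the indicator vector `x : V → Bool`, each coordinate
equal to `true` independently with probability `q`. -/
noncomputable def bwX (q : ℝ) (x : V → Bool) : ℝ :=
  q ^ (Finset.univ.filter fun v => x v = true).card *
    (1 - q) ^ (Finset.univ.filter fun v => x v = false).card

end Defs

/-- Solutions of a linear recursion and of its transpose have the same total. -/
lemma sum_eq_sum_of_transpose {α : Type*} (H : Finset α) (C : α → α → Prop) (f g : α → ℕ)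
    (hf : ∀ a ∈ H, f a = 1 + ∑ b ∈ H with C a b, f b)
    (hg : ∀ b ∈ H, g b = 1 + ∑ a ∈ H with C a b, g a) :
    ∑ a ∈ H, f a = ∑ a ∈ H, g a := by
  have h1 : ∑ a ∈ H, f a * g a = ∑ a ∈ H, g a + ∑ a ∈ H, ∑ b ∈ H with C a b, f b * g a := by
    rw [← Finset.sum_add_distrib]
    refine Finset.sum_congr rfl fun a ha => ?_
    rw [hf a ha, add_mul, one_mul, Finset.sum_mul]
  have h2 : ∑ a ∈ H, f a * g a = ∑ a ∈ H, f a + ∑ a ∈ H, ∑ b ∈ H with C b a, f a * g b := by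
    rw [← Finset.sum_add_distrib]
    refine Finset.sum_congr rfl fun a ha => ?_
    rw [hg a ha, mul_add, mul_one, Finset.mul_sum]
  have h3 : ∑ a ∈ H, ∑ b ∈ H with C a b, f b * g a = ∑ a ∈ H, ∑ b ∈ H with C b a, f a * g b := by
    simp only [Finset.sum_filter]
    exact Finset.sum_comm
  omega

section Greedy

variable {α : Type*} [DecidableEq α]

/-- All orderings of a finite set, as lists. -/
noncomputable def orderings (R : Finset α) : Finset (List α) := R.toList.permutations.toFinset

lemma mem_orderings {R : Finset α} {l : List α} : l ∈ orderings R ↔ l.Nodup ∧ l.toFinset = R := by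
  rw [orderings, List.mem_toFinset, List.mem_permutations]
  constructor
  · intro h
    exact ⟨h.nodup_iff.2 R.nodup_toList, by rw [List.toFinset_eq_of_perm _ _ h, toList_toFinset]⟩
  · rintro ⟨h, rfl⟩
    exact (List.perm_ext_iff_of_nodup h (nodup_toList _)).2 (by simp)

lemma card_orderings (R : Finset α) : (orderings R).card = R.card.factorial := by
  rw [orderings, List.toFinset_card_of_nodup (List.nodup_permutations _ R.nodup_toList),
    List.length_permutations, length_toList]

lemma sum_orderings {β : Type*} [AddCommMonoid β] {R : Finset α} (hR : R.Nonempty)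
    (F : List α → β) :
    ∑ l ∈ orderings R, F l = ∑ w ∈ R, ∑ l ∈ orderings (R.erase w), F (w :: l) := by
  rw [Finset.sum_sigma']
  symm
  refine Finset.sum_bij (fun x _ => x.1 :: x.2) ?_ ?_ ?_ (fun _ _ => rfl)
  · rintro ⟨w, l⟩ h
    simp only [mem_sigma, mem_orderings] at h
    obtain ⟨hw, hn, hl⟩ := h
    rw [mem_orderings, List.nodup_cons, List.toFinset_cons, hl, insert_erase hw]
    refine ⟨⟨?_, hn⟩, rfl⟩
    rw [← List.mem_toFinset, hl]
    simp
  · rintro ⟨w, l⟩ _ ⟨w', l'⟩ _ h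
    simp only [List.cons.injEq] at h
    obtain ⟨rfl, rfl⟩ := h
    rfl
  · intro l hl
    rw [mem_orderings] at hl
    obtain ⟨hn, rfl⟩ := hl
    cases l with
    | nil => simp at hR
    | cons w l =>
      rw [List.nodup_cons] at hn
      refine ⟨⟨w, l⟩, ?_, rfl⟩
      simp only [mem_sigma, mem_orderings]
      refine ⟨by simp, hn.2, ?_⟩
      rw [List.toFinset_cons, erase_insert (by simpa using hn.1)]

/-- `w` has no neighbour in `M`. -/
def IsFree (adj : α → α → Prop) (M : Finset α) (w : α) : Prop := ∀ m ∈ M, ¬ adj m w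

/-- One step of the greedy maximal independent set. -/
noncomputable def greedyStep (adj : α → α → Prop) (M : Finset α) (w : α) : Finset α :=
  if IsFree adj M w then insert w M else M

lemma IsFree.of_greedyStep {adj : α → α → Prop} {M : Finset α} {w c : α}
    (h : IsFree adj (greedyStep adj M w) c) : IsFree adj M c := by
  intro m hm
  apply h
  rw [greedyStep]
  split_ifs <;> simp [hm]

/-- The number of chains of oracle calls which end in a call on `a`, when the elements of the
list `l` arrive in this order and `M` is the greedy independent set built before. -/
noncomputable def callChains (adj : α → α → Prop) : Finset α → List α → α → ℕ
  | _, [], _ => 0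
  | M, w :: l, a =>
    if w = a then
      1 + ∑ c ∈ l.toFinset with adj a c ∧ IsFree adj M c, callChains adj (greedyStep adj M w) l c
    else callChains adj (greedyStep adj M w) l a

/-- The neighbours of `a` in `R` without neighbours in `M`. -/
noncomputable def freeNbrs (adj : α → α → Prop) (M R : Finset α) (a : α) : Finset α :=
  R.filter fun c => adj a c ∧ IsFree adj M c

lemma sum_card_freeNbrs_le {adj : α → α → Prop} (hs : ∀ a b, adj a b → adj b a)
    (hi : ∀ a, ¬ adj a a) (M R : Finset α) (a : α) (ha : a ∈ R) :
    ∑ w ∈ R.erase a, (freeNbrs adj (greedyStep adj M w) (R.erase w) a).card +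
      ∑ c ∈ freeNbrs adj M (R.erase a) a,
        (freeNbrs adj (greedyStep adj M a) (R.erase a) c).card +
      2 * (freeNbrs adj M R a).card ≤ R.card * (freeNbrs adj M R a).card := by
  have hD : freeNbrs adj M (R.erase a) a = freeNbrs adj M R a := by
    ext c
    simp only [freeNbrs, mem_filter, mem_erase]
    constructor
    · tauto
    · rintro ⟨h1, h2, h3⟩
      exact ⟨⟨fun h => hi a (h ▸ h2), h1⟩, h2, h3⟩
  have hswap : ∑ w ∈ R.erase a, (freeNbrs adj (greedyStep adj M w) (R.erase w) a).card =
      ∑ c ∈ freeNbrs adj M R a,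
        ((R.erase a).filter fun w => w ≠ c ∧ IsFree adj (greedyStep adj M w) c).card := by
    have h1 : ∀ w, freeNbrs adj (greedyStep adj M w) (R.erase w) a =
        (freeNbrs adj M R a).filter fun c => w ≠ c ∧ IsFree adj (greedyStep adj M w) c := by
      intro w
      ext c
      simp only [freeNbrs, mem_filter, mem_erase]
      constructor
      · rintro ⟨⟨h1, h2⟩, h3, h4⟩
        exact ⟨⟨h2, h3, h4.of_greedyStep⟩, h1.symm, h4⟩
      · rintro ⟨⟨h1, h2, h3⟩, h4, h5⟩
        exact ⟨⟨h4.symm, h1⟩, h2, h5⟩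
    simp only [h1, card_filter (fun c => _ ≠ c ∧ _), card_filter (fun w => w ≠ _ ∧ _)]
    exact Finset.sum_comm
  rw [hD, hswap, ← Finset.sum_add_distrib, mul_comm 2, mul_comm R.card, ← smul_eq_mul,
    ← smul_eq_mul (a := (freeNbrs adj M R a).card) (b := R.card), ← Finset.sum_const,
    ← Finset.sum_const, ← Finset.sum_add_distrib]
  refine Finset.sum_le_sum fun c hc => ?_
  simp only [freeNbrs, mem_filter] at hc
  obtain ⟨hcR, hac, hfc⟩ := hc
  have hca : c ≠ a := fun h => hi a (h ▸ hac)
  have hcard : ((R.erase a).erase c).card + 2 = R.card := by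
    have h1 := card_erase_add_one (mem_erase.2 ⟨hca, hcR⟩)
    have h2 := card_erase_add_one ha
    omega
  rw [← hcard, ← card_union_of_disjoint]
  · gcongr
    intro w hw
    simp only [freeNbrs, mem_union, mem_filter, mem_erase] at hw ⊢
    rcases hw with ⟨h1, h2, -⟩ | ⟨h1, h2, -⟩
    · exact ⟨h2, h1⟩
    · exact ⟨fun h => hi c (h ▸ h2), h1⟩
  · rw [Finset.disjoint_left]
    intro w hw hw'
    simp only [freeNbrs, mem_filter, mem_erase] at hw hw'
    obtain ⟨-, h2, h3⟩ := hw'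
    have := hw.2.2
    rw [greedyStep, if_pos h3.of_greedyStep] at this
    exact this w (by simp) (hs _ _ h2)

/-- Averaged over all orderings of `R`, at most `1 + d / 2` chains of calls end in a given
element with `d` free neighbours. -/
theorem sum_callChains_le {adj : α → α → Prop} (hs : ∀ a b, adj a b → adj b a)
    (hi : ∀ a, ¬ adj a a) (n : ℕ) (R : Finset α) (hn : R.card = n) (M : Finset α) (a : α)
    (ha : a ∈ R) :
    (∑ l ∈ orderings R, (callChains adj M l a : ℝ)) ≤
      n.factorial * (1 + (freeNbrs adj M R a).card / 2) := by
  induction n generalizing R M a with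
  | zero => simp [card_eq_zero.1 hn] at ha
  | succ n ih =>
    have hcard : ∀ w ∈ R, (R.erase w).card = n := fun w hw => by
      rw [card_erase_of_mem hw, hn]; rfl
    rw [sum_orderings ⟨a, ha⟩, ← Finset.add_sum_erase _ _ ha]
    have h1 : (∑ l ∈ orderings (R.erase a), (callChains adj M (a :: l) a : ℝ)) ≤
        n.factorial + ∑ c ∈ freeNbrs adj M (R.erase a) a, (n.factorial : ℝ) *
          (1 + (freeNbrs adj (greedyStep adj M a) (R.erase a) c).card / 2) := by
      have h : ∀ l ∈ orderings (R.erase a), (callChains adj M (a :: l) a : ℝ) =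
          1 + ∑ c ∈ freeNbrs adj M (R.erase a) a,
            (callChains adj (greedyStep adj M a) l c : ℝ) := by
        intro l hl
        rw [callChains, if_pos rfl, (mem_orderings.1 hl).2]
        push_cast
        rfl
      rw [Finset.sum_congr rfl h, Finset.sum_add_distrib, Finset.sum_comm]
      gcongr with c hc
      · simp [card_orderings, hcard a ha]
      · exact ih _ (hcard a ha) _ _ (mem_filter.1 hc).1
    have h2 : ∀ w ∈ R.erase a, (∑ l ∈ orderings (R.erase w), (callChains adj M (w :: l) a : ℝ)) ≤
        n.factorial * (1 + (freeNbrs adj (greedyStep adj M w) (R.erase w) a).card / 2) := by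
      intro w hw
      rw [mem_erase] at hw
      simp only [callChains, if_neg hw.1]
      exact ih _ (hcard w hw.2) _ _ (mem_erase.2 ⟨hw.1.symm, ha⟩)
    refine (add_le_add h1 (Finset.sum_le_sum h2)).trans ?_
    have key := sum_card_freeNbrs_le hs hi M R a ha
    have hle : (freeNbrs adj M (R.erase a) a).card ≤ (freeNbrs adj M R a).card :=
      card_le_card (filter_subset_filter _ (erase_subset _ _))
    clear h1 h2 ih
    rw [hn] at key
    have key' : ((_ : ℕ) : ℝ) ≤ ((_ : ℕ) : ℝ) := Nat.cast_le.2 key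
    have hle' : ((_ : ℕ) : ℝ) ≤ ((_ : ℕ) : ℝ) := Nat.cast_le.2 hle
    push_cast at key'
    rw [← Finset.mul_sum, ← Finset.mul_sum, Finset.sum_add_distrib, Finset.sum_add_distrib,
      ← Finset.sum_div, ← Finset.sum_div, Finset.sum_const, Finset.sum_const, hcard a ha,
      Nat.factorial_succ, nsmul_eq_mul, nsmul_eq_mul]
    push_cast
    have hf : (0 : ℝ) ≤ n.factorial := by positivity
    generalize (∑ w ∈ R.erase a, _ : ℝ) = A at *
    generalize (∑ w ∈ freeNbrs adj M (R.erase a) a, _ : ℝ) = B at *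
    have : (1 + ((freeNbrs adj M (R.erase a) a).card * 1 + B / 2) + (n * 1 + A / 2) : ℝ) ≤
        (n + 1) * (1 + (freeNbrs adj M R a).card / 2) := by linarith
    linarith [mul_le_mul_of_nonneg_left this hf]

lemma callChains_append {adj : α → α → Prop} (M : Finset α) (pre suf : List α) (a : α)
    (h : a ∉ pre) :
    callChains adj M (pre ++ suf) a = callChains adj (pre.foldl (greedyStep adj) M) suf a := by
  induction pre generalizing M with
  | nil => rfl
  | cons w l ih =>
    simp only [List.mem_cons, not_or] at h
    rw [List.cons_append, callChains, if_neg (Ne.symm h.1), ih _ h.2, List.foldl_cons]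

lemma mem_foldl_greedyStep {adj : α → α → Prop} {prio : α → ℕ} {l : List α}
    (hl : l.Pairwise fun a b => prio a < prio b) {ans : α → Prop}
    (hans : ∀ e ∈ l, ans e ↔ ∀ f ∈ l, adj f e → prio f < prio e → ¬ ans f)
    (pre suf : List α) (h : l = pre ++ suf) (f : α) :
    f ∈ pre.foldl (greedyStep adj) ∅ ↔ f ∈ pre ∧ ans f := by
  induction pre using List.reverseRecOn generalizing suf f with
  | nil => simp
  | append_singleton pre w ih =>
    have ih := ih (w :: suf) (by simpa using h)
    have hfree : IsFree adj (pre.foldl (greedyStep adj) ∅) w ↔ ans w := by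
      rw [hans w (by simp [h])]
      have hlt : ∀ f ∈ l, prio f < prio w ↔ f ∈ pre := by
        rw [h, List.pairwise_append, List.pairwise_append] at hl
        intro f hf
        simp only [h, List.mem_append, List.mem_singleton] at hf
        constructor
        · intro h1
          rcases hf with (hf | rfl) | hf
          · exact hf
          · exact absurd h1 (lt_irrefl _)
          · exact absurd (hl.2.2 w (by simp) f hf) h1.asymm
        · intro h1
          exact hl.1.2.2 f h1 w (by simp)
      constructor
      · intro h1 f hf hadj hf' hans'
        exact h1 f ((ih f).2 ⟨(hlt f hf).1 hf', hans'⟩) hadj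
      · intro h1 f hf hadj
        have := (ih f).1 hf
        have hfl : f ∈ l := by simp [h, this.1]
        exact h1 f hfl hadj ((hlt f hfl).2 this.1) this.2
    rw [List.foldl_append, List.foldl_cons, List.foldl_nil, greedyStep]
    split_ifs with hw
    · rw [hfree] at hw
      rw [mem_insert, ih f]
      simp only [List.mem_append, List.mem_singleton]
      constructor
      · rintro (rfl | h1)
        · exact ⟨Or.inr rfl, hw⟩
        · exact ⟨Or.inl h1.1, h1.2⟩
      · rintro ⟨h1 | rfl, h2⟩
        · exact Or.inr ⟨h1, h2⟩
        · exact Or.inl rfl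
    · rw [hfree] at hw
      rw [ih f]
      simp only [List.mem_append, List.mem_singleton]
      constructor
      · rintro h1
        exact ⟨Or.inl h1.1, h1.2⟩
      · rintro ⟨h1 | rfl, h2⟩
        · exact ⟨h1, h2⟩
        · exact absurd h2 hw

lemma callChains_eq {adj : α → α → Prop} {prio : α → ℕ} {l : List α}
    (hl : l.Pairwise fun a b => prio a < prio b) {ans : α → Prop}
    (hans : ∀ e ∈ l, ans e ↔ ∀ f ∈ l, adj f e → prio f < prio e → ¬ ans f)
    (a : α) (ha : a ∈ l) :
    callChains adj ∅ l a = 1 + ∑ c ∈ l.toFinset with prio a < prio c ∧ adj a c ∧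
      ∀ f ∈ l, adj f c → prio f < prio a → ¬ ans f, callChains adj ∅ l c := by
  obtain ⟨pre, suf, h⟩ := List.append_of_mem ha
  have hl' := hl
  rw [h, List.pairwise_append, List.pairwise_cons] at hl'
  obtain ⟨hpre, ⟨hasuf, hsuf⟩, hps⟩ := hl'
  have hapre : a ∉ pre := fun h1 => lt_irrefl _ (hps a h1 a (by simp))
  have hM := mem_foldl_greedyStep hl hans pre (a :: suf) h
  have hlt : ∀ f ∈ l, prio f < prio a ↔ f ∈ pre := by
    intro f hf
    simp only [h, List.mem_append, List.mem_cons] at hf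
    constructor
    · intro h1
      rcases hf with hf | rfl | hf
      · exact hf
      · exact absurd h1 (lt_irrefl _)
      · exact absurd (hasuf f hf) h1.asymm
    · intro h1
      exact hps f h1 a (by simp)
  have hgt : ∀ f ∈ l, prio a < prio f ↔ f ∈ suf := by
    intro f hf
    simp only [h, List.mem_append, List.mem_cons] at hf
    constructor
    · intro h1
      rcases hf with hf | rfl | hf
      · exact absurd (hps f hf a (by simp)) h1.asymm
      · exact absurd h1 (lt_irrefl _)
      · exact hf
    · intro h1
      exact hasuf f h1
  have hset : suf.toFinset.filter
      (fun c => adj a c ∧ IsFree adj (pre.foldl (greedyStep adj) ∅) c) =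
      l.toFinset.filter (fun c => prio a < prio c ∧ adj a c ∧
        ∀ f ∈ l, adj f c → prio f < prio a → ¬ ans f) := by
    ext c
    simp only [mem_filter, List.mem_toFinset]
    constructor
    · rintro ⟨h1, h2, h3⟩
      have hcl : c ∈ l := by simp [h, h1]
      refine ⟨hcl, (hgt c hcl).2 h1, h2, fun f hf hfc hfa hans' => ?_⟩
      exact h3 f ((hM f).2 ⟨(hlt f hf).1 hfa, hans'⟩) hfc
    · rintro ⟨h0, h1, h2, h3⟩
      refine ⟨(hgt c h0).1 h1, h2, fun f hf hfc => ?_⟩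
      have h4 := (hM f).1 hf
      have hfl : f ∈ l := by simp [h, h4.1]
      exact h3 f hfl hfc ((hlt f hfl).2 h4.1) h4.2
  have hunfold : callChains adj ∅ l a = 1 + ∑ c ∈ suf.toFinset.filter
      (fun c => adj a c ∧ IsFree adj (pre.foldl (greedyStep adj) ∅) c),
      callChains adj (greedyStep adj (pre.foldl (greedyStep adj) ∅) a) suf c := by
    rw [h, callChains_append _ _ _ _ hapre, callChains, if_pos rfl]
  rw [hunfold, ← hset]
  congr 1
  refine Finset.sum_congr rfl fun c hc => ?_
  simp only [mem_filter, List.mem_toFinset] at hc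
  have hc' : c ∉ pre ++ [a] := by
    simp only [List.mem_append, List.mem_singleton, not_or]
    refine ⟨fun h1 => ?_, fun h1 => ?_⟩
    · exact lt_irrefl _ (hps c h1 c (by simp [hc.1]))
    · exact lt_irrefl _ (h1 ▸ hasuf c hc.1)
  have h' : l = (pre ++ [a]) ++ suf := by simp [h]
  rw [h', callChains_append _ _ _ _ hc', List.foldl_append]
  rfl

end Greedy

section Oracle

variable {V : Type*}

/-- One step of the loop of the edge oracle, with the recursive calls answered by `T`. -/
noncomputable def oracleStep [DecidableEq V] (T : Sym2 V → Bool × Finset V × ℕ) (s : Bool × Finset V × ℕ)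
    (f : Sym2 V) : Bool × Finset V × ℕ :=
  if s.1 then s else ((T f).1, s.2.1 ∪ (T f).2.1, s.2.2 + (T f).2.2)

/-- The edges of `L` examined by the edge oracle on `e`. -/
noncomputable def lowerNbrs [Fintype V] [DecidableEq V] (π : Sym2 V → ℕ) (L : Finset (Sym2 V)) (e : Sym2 V) :
    Finset (Sym2 V) :=
  L.filter fun f => f ≠ e ∧ (∃ v, v ∈ e ∧ v ∈ f) ∧ π f < π e

/-- `lowerNbrs` in increasing order of priority. -/
noncomputable def lowerNbrsList [Fintype V] [DecidableEq V] (π : Sym2 V → ℕ) (L : Finset (Sym2 V)) (e : Sym2 V) :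
    List (Sym2 V) :=
  (lowerNbrs π L e).toList.mergeSort (fun a b => decide (π a ≤ π b))

lemma mem_lowerNbrsList [Fintype V] [DecidableEq V] {π : Sym2 V → ℕ} {L : Finset (Sym2 V)} {e f : Sym2 V} :
    f ∈ lowerNbrsList π L e ↔ f ∈ lowerNbrs π L e := by
  rw [lowerNbrsList, (List.mergeSort_perm _ _).mem_iff, mem_toList]

lemma pairwise_lowerNbrsList [Fintype V] [DecidableEq V] {π : Sym2 V → ℕ} {L : Finset (Sym2 V)} (hπ : Set.InjOn π L)
    (e : Sym2 V) : (lowerNbrsList π L e).Pairwise fun a b => π a < π b := by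
  have h1 : (lowerNbrsList π L e).Pairwise fun a b => π a ≤ π b := by
    have := List.pairwise_mergeSort (le := fun a b : Sym2 V => decide (π a ≤ π b))
      (fun a b c => by simpa using le_trans) (fun a b => by simpa using le_total _ _)
      (lowerNbrs π L e).toList
    simpa [lowerNbrsList] using this
  have h2 : (lowerNbrsList π L e).Nodup :=
    (List.mergeSort_perm _ _).nodup_iff.2 (nodup_toList _)
  refine (h1.and h2).imp_of_mem fun {a b} ha hb h => lt_of_le_of_ne h.1 fun hab => h.2 ?_
  exact hπ (mem_filter.1 (mem_lowerNbrsList.1 ha)).1 (mem_filter.1 (mem_lowerNbrsList.1 hb)).1 hab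

lemma eoQ_succ [Fintype V] [DecidableEq V] (π : Sym2 V → ℕ) (L : Finset (Sym2 V)) (x : V → Bool) (n : ℕ) (e : Sym2 V) :
    eoQ π L x (n + 1) e = if ∀ v ∈ e, x v then
      (!((lowerNbrsList π L e).foldl (oracleStep (eoQ π L x n)) (false, ∅, 0)).1,
        ends e ∪ ((lowerNbrsList π L e).foldl (oracleStep (eoQ π L x n)) (false, ∅, 0)).2.1,
        (if e ∈ L then 1 else 0) +
          ((lowerNbrsList π L e).foldl (oracleStep (eoQ π L x n)) (false, ∅, 0)).2.2)
    else (false, ends e, 0) := by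
  rw [eoQ]
  rfl

lemma foldl_oracleStep_congr [DecidableEq V] {l : List (Sym2 V)} {T T' : Sym2 V → Bool × Finset V × ℕ}
    (h : ∀ f ∈ l, T f = T' f) (s : Bool × Finset V × ℕ) :
    l.foldl (oracleStep T) s = l.foldl (oracleStep T') s :=
  List.foldl_ext _ _ _ fun a b hb => by rw [oracleStep, oracleStep, h b hb]

lemma eoQ_eq_edgeOracle [Fintype V] [DecidableEq V] (π : Sym2 V → ℕ) (L : Finset (Sym2 V)) (x : V → Bool) (n : ℕ)
    (e : Sym2 V) (h : π e < n) : eoQ π L x n e = edgeOracle π L x e := by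
  induction n using Nat.strong_induction_on generalizing e with
  | _ n ih =>
    obtain ⟨n, rfl⟩ : ∃ m, n = m + 1 := ⟨n - 1, by omega⟩
    rcases (Nat.lt_succ_iff.1 h).eq_or_lt with rfl | hlt
    · rfl
    have hc : ∀ s, (lowerNbrsList π L e).foldl (oracleStep (eoQ π L x n)) s =
        (lowerNbrsList π L e).foldl (oracleStep (eoQ π L x (π e))) s := by
      refine foldl_oracleStep_congr fun f hf => ?_
      have hf' := (mem_filter.1 (mem_lowerNbrsList.1 hf)).2.2.2
      rw [ih n (by omega) f (by omega), ih (π e) (by omega) f hf']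
    rw [edgeOracle, eoQ_succ, eoQ_succ, hc]

lemma edgeOracle_eq [Fintype V] [DecidableEq V] (π : Sym2 V → ℕ) (L : Finset (Sym2 V)) (x : V → Bool) (e : Sym2 V)
    (hx : ∀ v ∈ e, x v) :
    edgeOracle π L x e =
      (!((lowerNbrsList π L e).foldl (oracleStep (edgeOracle π L x)) (false, ∅, 0)).1,
        ends e ∪ ((lowerNbrsList π L e).foldl (oracleStep (edgeOracle π L x)) (false, ∅, 0)).2.1,
        (if e ∈ L then 1 else 0) +
          ((lowerNbrsList π L e).foldl (oracleStep (edgeOracle π L x)) (false, ∅, 0)).2.2) := by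
  have hc : ∀ s, (lowerNbrsList π L e).foldl (oracleStep (eoQ π L x (π e))) s =
      (lowerNbrsList π L e).foldl (oracleStep (edgeOracle π L x)) s :=
    foldl_oracleStep_congr fun f hf =>
      eoQ_eq_edgeOracle π L x _ f (mem_filter.1 (mem_lowerNbrsList.1 hf)).2.2.2
  rw [edgeOracle, eoQ_succ, if_pos hx, hc]

lemma edgeOracle_eq_of_not [Fintype V] [DecidableEq V] (π : Sym2 V → ℕ) (L : Finset (Sym2 V)) (x : V → Bool) (e : Sym2 V)
    (hx : ¬ ∀ v ∈ e, x v) : edgeOracle π L x e = (false, ends e, 0) := by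
  rw [edgeOracle, eoQ_succ, if_neg hx]

lemma foldl_oracleStep_of_true [DecidableEq V] (T : Sym2 V → Bool × Finset V × ℕ) (l : List (Sym2 V))
    (s : Bool × Finset V × ℕ) (hs : s.1 = true) : l.foldl (oracleStep T) s = s := by
  induction l with
  | nil => rfl
  | cons f l ih => rw [List.foldl_cons, oracleStep, if_pos hs, ih]

lemma foldl_oracleStep [Fintype V] [DecidableEq V] {π : Sym2 V → ℕ} (T : Sym2 V → Bool × Finset V × ℕ) (l : List (Sym2 V))
    (hl : l.Pairwise fun a b => π a < π b) (s : Bool × Finset V × ℕ) (hs : s.1 = false) :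
    ((l.foldl (oracleStep T) s).1 = true ↔ ∃ f ∈ l, (T f).1 = true) ∧
    (l.foldl (oracleStep T) s).2.2 = s.2.2 +
      ∑ f ∈ l.toFinset with ∀ g ∈ l, π g < π f → (T g).1 = false, (T f).2.2 := by
  induction l generalizing s with
  | nil => simp [hs]
  | cons f l ih =>
    rw [List.pairwise_cons] at hl
    have hstep : oracleStep T s f = ((T f).1, s.2.1 ∪ (T f).2.1, s.2.2 + (T f).2.2) := by
      rw [oracleStep, hs]; rfl
    rw [List.foldl_cons]
    rcases hT : (T f).1 with _ | _
    · obtain ⟨h1, h2⟩ := ih hl.2 (oracleStep T s f) (by rw [hstep, hT])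
      rw [h1, h2, hstep]
      refine ⟨by simp [hT], ?_⟩
      have hfl : f ∉ l := fun h => lt_irrefl _ (hl.1 f h)
      have hset : (f :: l).toFinset.filter
          (fun a => ∀ g ∈ f :: l, π g < π a → (T g).1 = false) =
          insert f (l.toFinset.filter fun a => ∀ g ∈ l, π g < π a → (T g).1 = false) := by
        ext a
        simp only [mem_filter, List.mem_toFinset, List.mem_cons, mem_insert]
        constructor
        · rintro ⟨rfl | h, h'⟩
          · exact Or.inl rfl
          · exact Or.inr ⟨h, fun g hg => h' g (Or.inr hg)⟩
        · rintro (rfl | ⟨h, h'⟩)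
          · refine ⟨Or.inl rfl, ?_⟩
            rintro g (rfl | hg) hlt
            · exact hT
            · exact absurd (hl.1 g hg) hlt.asymm
          · refine ⟨Or.inr h, ?_⟩
            rintro g (rfl | hg) hlt
            · exact hT
            · exact h' g hg hlt
      rw [hset, Finset.sum_insert (by simp [hfl]), add_assoc]
    · rw [foldl_oracleStep_of_true _ _ _ (by rw [hstep, hT]), hstep]
      refine ⟨by simp [hT], ?_⟩
      have hset : (f :: l).toFinset.filter
          (fun a => ∀ g ∈ f :: l, π g < π a → (T g).1 = false) = {f} := by
        ext a
        simp only [mem_filter, List.mem_toFinset, List.mem_cons, mem_singleton]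
        constructor
        · rintro ⟨rfl | h, h'⟩
          · rfl
          · simpa [hT] using h' f (Or.inl rfl) (hl.1 a h)
        · rintro rfl
          refine ⟨Or.inl rfl, ?_⟩
          rintro g (rfl | hg) hlt
          · exact absurd hlt (lt_irrefl _)
          · exact absurd (hl.1 g hg) hlt.asymm
      rw [hset, Finset.sum_singleton]

/-- Two distinct edges of `H` sharing a vertex. -/
def Incident (H : Finset (Sym2 V)) (e f : Sym2 V) : Prop :=
  e ∈ H ∧ f ∈ H ∧ f ≠ e ∧ ∃ v, v ∈ e ∧ v ∈ f

lemma Incident.symm {H : Finset (Sym2 V)} {e f : Sym2 V} (h : Incident H e f) :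
    Incident H f e :=
  ⟨h.2.1, h.1, h.2.2.1.symm, h.2.2.2.imp fun _ => And.symm⟩

lemma edgeOracle_fst_eq_true_iff [Fintype V] [DecidableEq V] {π : Sym2 V → ℕ} {L : Finset (Sym2 V)} (hπ : Set.InjOn π L)
    (x : V → Bool) {e : Sym2 V} (he : e ∈ partEdges L x) :
    (edgeOracle π L x e).1 = true ↔ ∀ f, Incident (partEdges L x) f e → π f < π e →
      ¬ (edgeOracle π L x f).1 = true := by
  have hx := (mem_filter.1 he).2
  have h := (foldl_oracleStep (edgeOracle π L x) _ (pairwise_lowerNbrsList hπ e)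
    (false, ∅, 0) rfl).1
  rw [edgeOracle_eq π L x e hx]
  simp only [Bool.not_eq_true', ← Bool.not_eq_true, h, not_exists, not_and]
  constructor
  · intro h f hf hlt
    exact h f (mem_lowerNbrsList.2 (mem_filter.2
      ⟨(mem_filter.1 hf.1).1, hf.symm.2.2.1, hf.symm.2.2.2, hlt⟩))
  · intro h f hf hans
    obtain ⟨hfL, hne, hinc, hlt⟩ := mem_filter.1 (mem_lowerNbrsList.1 hf)
    by_cases hxf : ∀ v ∈ f, x v
    · exact h f (Incident.symm ⟨he, mem_filter.2 ⟨hfL, hxf⟩, hne, hinc⟩) hlt hans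
    · rw [edgeOracle_eq_of_not _ _ _ _ hxf] at hans
      exact absurd hans (by simp)

lemma edgeOracle_count_eq [Fintype V] [DecidableEq V] {π : Sym2 V → ℕ} {L : Finset (Sym2 V)} (hπ : Set.InjOn π L)
    (x : V → Bool) {e : Sym2 V} (he : e ∈ partEdges L x) :
    (edgeOracle π L x e).2.2 = 1 + ∑ f ∈ partEdges L x with π f < π e ∧
      Incident (partEdges L x) f e ∧ ∀ g, Incident (partEdges L x) g e → π g < π f →
        ¬ (edgeOracle π L x g).1 = true, (edgeOracle π L x f).2.2 := by
  have hx := (mem_filter.1 he).2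
  have h := (foldl_oracleStep (edgeOracle π L x) _ (pairwise_lowerNbrsList hπ e)
    (false, ∅, 0) rfl).2
  rw [edgeOracle_eq π L x e hx]
  simp only [h, if_pos (mem_filter.1 he).1, zero_add]
  congr 1
  symm
  apply Finset.sum_subset_zero_on_sdiff
  · intro f hf
    simp only [mem_filter, List.mem_toFinset, mem_lowerNbrsList] at hf ⊢
    obtain ⟨hfH, hlt, hinc, hno⟩ := hf
    refine ⟨mem_filter.2 ⟨(mem_filter.1 hfH).1, hinc.symm.2.2.1, hinc.symm.2.2.2, hlt⟩,
      fun g hg hgf => ?_⟩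
    obtain ⟨hgL, hgne, hginc, -⟩ := mem_filter.1 hg
    by_cases hxg : ∀ v ∈ g, x v
    · simpa using hno g (Incident.symm ⟨he, mem_filter.2 ⟨hgL, hxg⟩, hgne, hginc⟩) hgf
    · rw [edgeOracle_eq_of_not _ _ _ _ hxg]
  · intro f hf
    simp only [mem_sdiff, mem_filter, List.mem_toFinset, mem_lowerNbrsList] at hf
    obtain ⟨⟨hfl, hno⟩, hf⟩ := hf
    obtain ⟨hfL, hne, hinc, hlt⟩ := mem_filter.1 hfl
    by_cases hxf : ∀ v ∈ f, x v
    · refine absurd ⟨mem_filter.2 ⟨hfL, hxf⟩, hlt,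
        Incident.symm ⟨he, mem_filter.2 ⟨hfL, hxf⟩, hne, hinc⟩, fun g hg hgf => ?_⟩ hf
      have := hno g (mem_filter.2 ⟨(mem_filter.1 hg.1).1, hg.symm.2.2.1, hg.symm.2.2.2,
        hgf.trans hlt⟩) hgf
      simp [this]
    · rw [edgeOracle_eq_of_not _ _ _ _ hxf]
  · intro _ _
    rfl

/-- The total oracle cost counts the chains of calls by their last element. -/
lemma sum_edgeOracle_eq [Fintype V] [DecidableEq V] {π : Sym2 V → ℕ} {L : Finset (Sym2 V)} (hπ : Set.InjOn π L)
    (x : V → Bool) (l : List (Sym2 V)) (hl : l.Pairwise fun a b => π a < π b)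
    (hL : ∀ e ∈ L, e ∈ l) :
    ∑ e ∈ partEdges L x, (edgeOracle π L x e).2.2 =
      ∑ e ∈ partEdges L x, callChains (Incident (partEdges L x)) ∅ l e := by
  have hHl : ∀ e ∈ partEdges L x, e ∈ l := fun e he => hL e (mem_filter.1 he).1
  refine sum_eq_sum_of_transpose _ (fun e f => π f < π e ∧
    Incident (partEdges L x) f e ∧ ∀ g, Incident (partEdges L x) g e → π g < π f →
      ¬ (edgeOracle π L x g).1 = true) _ _ (fun e he => ?_) ?_
  · convert edgeOracle_count_eq hπ x he
  intro a ha
  have hans : ∀ e ∈ l, (e ∉ partEdges L x ∨ (edgeOracle π L x e).1 = true) ↔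
      ∀ f ∈ l, Incident (partEdges L x) f e → π f < π e →
        ¬ (f ∉ partEdges L x ∨ (edgeOracle π L x f).1 = true) := by
    intro e _
    by_cases he : e ∈ partEdges L x
    · simp only [he, not_true, false_or, edgeOracle_fst_eq_true_iff hπ x he]
      constructor
      · rintro h f _ hf hlt (h' | h')
        · exact h' hf.1
        · exact h f hf hlt h'
      · intro h f hf hlt hans
        exact h f (hHl f hf.1) hf hlt (Or.inr hans)
    · simp only [he, not_false_eq_true, true_or, true_iff]
      exact fun f _ hf => absurd hf.2.1 he
  rw [callChains_eq hl hans a (hHl a ha)]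
  congr 1
  refine Finset.sum_congr ?_ fun _ _ => rfl
  ext c
  simp only [mem_filter, List.mem_toFinset]
  constructor
  · rintro ⟨-, hlt, hinc, hno⟩
    refine ⟨hinc.2.1, hlt, hinc, fun g hg hga hans => ?_⟩
    exact hno g (hHl g hg.1) hg hga (Or.inr hans)
  · rintro ⟨hc, hlt, hinc, hno⟩
    refine ⟨hHl c hc, hlt, hinc, ?_⟩
    rintro g _ hg hga (h | h)
    · exact h hg.1
    · exact hno g hg hga h

/-- The ordering of `E` given by the priorities `prioOf E τ`. -/
noncomputable def orderingOf (E : Finset (Sym2 V)) (τ : Equiv.Perm (Fin E.card)) :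
    List (Sym2 V) :=
  List.ofFn fun i => (E.equivFin.symm (τ.symm i) : Sym2 V)

lemma prioOf_equivFin_symm [DecidableEq V] (E : Finset (Sym2 V)) (τ : Equiv.Perm (Fin E.card))
    (i : Fin E.card) : prioOf E τ (E.equivFin.symm (τ.symm i)) = i := by
  simp [prioOf]

lemma pairwise_orderingOf [DecidableEq V] (E : Finset (Sym2 V)) (τ : Equiv.Perm (Fin E.card)) :
    (orderingOf E τ).Pairwise fun a b => prioOf E τ a < prioOf E τ b := by
  rw [orderingOf, List.pairwise_ofFn]
  intro i j hij
  simp only [prioOf_equivFin_symm]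
  exact hij

lemma orderingOf_mem [DecidableEq V] (E : Finset (Sym2 V)) (τ : Equiv.Perm (Fin E.card)) :
    orderingOf E τ ∈ orderings E := by
  rw [mem_orderings]
  refine ⟨(pairwise_orderingOf E τ).imp fun h h' => by simp [h'] at h, ?_⟩
  ext e
  rw [List.mem_toFinset, orderingOf, List.mem_ofFn]
  constructor
  · rintro ⟨i, rfl⟩
    exact Subtype.coe_prop _
  · intro he
    exact ⟨τ (E.equivFin ⟨e, he⟩), by simp⟩

lemma orderingOf_injective (E : Finset (Sym2 V)) : Function.Injective (orderingOf E) := by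
  intro τ τ' h
  have h := List.ofFn_injective h
  have : τ.symm = τ'.symm := by
    ext i
    have h := congrFun h i
    rw [Subtype.coe_inj, E.equivFin.symm.injective.eq_iff] at h
    rw [h]
  simpa using congrArg Equiv.symm this

lemma injOn_prioOf [DecidableEq V] (E : Finset (Sym2 V)) (τ : Equiv.Perm (Fin E.card)) :
    Set.InjOn (prioOf E τ) E := by
  intro e he f hf h
  rw [mem_coe] at he hf
  rw [prioOf, prioOf, dif_pos he, dif_pos hf, ← Fin.ext_iff] at h
  simpa using h

/-- The total cost of the oracle, summed over all priorities, is controlled by the number of edges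
and of pairs of incident edges inside the part. -/
theorem sum_sum_edgeOracle_le [Fintype V] [DecidableEq V] (E S : Finset (Sym2 V)) (hS : S ⊆ E) (x : V → Bool) :
    ∑ τ : Equiv.Perm (Fin E.card), ∑ e ∈ partEdges S x,
        ((edgeOracle (prioOf E τ) S x e).2.2 : ℝ) ≤
      (E.card.factorial : ℝ) * ∑ e ∈ partEdges S x,
        (1 + ((E.filter fun f => Incident (partEdges S x) e f).card : ℝ) / 2) := by
  have h1 : ∀ τ : Equiv.Perm (Fin E.card), ∑ e ∈ partEdges S x,
        ((edgeOracle (prioOf E τ) S x e).2.2 : ℝ) =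
      ∑ e ∈ partEdges S x,
        (callChains (Incident (partEdges S x)) ∅ (orderingOf E τ) e : ℝ) := by
    intro τ
    exact_mod_cast sum_edgeOracle_eq ((injOn_prioOf E τ).mono (by exact_mod_cast hS)) x
      _ (pairwise_orderingOf E τ) fun e he => by
        rw [← List.mem_toFinset, (mem_orderings.1 (orderingOf_mem E τ)).2]
        exact hS he
  simp only [h1]
  rw [Finset.sum_comm, Finset.mul_sum]
  refine Finset.sum_le_sum fun e he => ?_
  calc ∑ τ, (callChains (Incident (partEdges S x)) ∅ (orderingOf E τ) e : ℝ)
      = ∑ l ∈ Finset.univ.image (orderingOf E),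
          (callChains (Incident (partEdges S x)) ∅ l e : ℝ) := by
        rw [Finset.sum_image (orderingOf_injective E).injOn]
    _ ≤ ∑ l ∈ orderings E, (callChains (Incident (partEdges S x)) ∅ l e : ℝ) := by
        refine Finset.sum_le_sum_of_subset_of_nonneg ?_ fun _ _ _ => Nat.cast_nonneg _
        intro l hl
        obtain ⟨τ, -, rfl⟩ := mem_image.1 hl
        exact orderingOf_mem E τ
    _ ≤ _ := by
        have := sum_callChains_le (adj := Incident (partEdges S x)) (fun _ _ => Incident.symm)
          (fun a h => h.2.2.1 rfl) _ E rfl ∅ e (hS (mem_filter.1 he).1)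
        simpa [freeNbrs, IsFree] using this

end Oracle

section Expectation

variable {V : Type*}

/-- A fixed set of edges is sampled with probability `p ^ T.card`. -/
lemma sum_bwE_superset [DecidableEq V] (p : ℝ) {E T : Finset (Sym2 V)} (hT : T ⊆ E) :
    ∑ S ∈ E.powerset, (if T ⊆ S then bwE p E S else 0) = p ^ T.card := by
  have h := Finset.prod_add (fun _ => p) (fun e => if e ∈ T then 0 else 1 - p) E
  have h1 : ∏ e ∈ E, (p + if e ∈ T then 0 else 1 - p) = p ^ T.card := by
    have : ∀ e ∈ E, (p + if e ∈ T then 0 else 1 - p) = if e ∈ T then p else 1 := by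
      intro e _
      split_ifs <;> ring
    rw [Finset.prod_congr rfl this, Finset.prod_ite_mem, inter_eq_right.2 hT, Finset.prod_const]
  rw [← h1, h]
  refine Finset.sum_congr rfl fun S hS => ?_
  rw [mem_powerset] at hS
  rw [Finset.prod_const]
  split_ifs with hTS
  · rw [bwE, ← card_sdiff_of_subset hS, ← Finset.prod_const (1 - p)]
    congr 1
    refine Finset.prod_congr rfl fun e he => ?_
    rw [if_neg fun h => (mem_sdiff.1 he).2 (hTS h)]
  · obtain ⟨e, heT, heS⟩ := not_subset.1 hTS
    refine (mul_eq_zero_of_right _ ?_).symm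
    exact Finset.prod_eq_zero (mem_sdiff.2 ⟨hT heT, heS⟩) (if_pos heT)

/-- All vertices of a fixed set receive a given part with probability `k ^ (-A.card)`. -/
lemma sum_coloring_eq [Fintype V] [DecidableEq V] (k : ℕ) (c : Fin k) (A : Finset V) :
    ∑ χ : V → Fin k, (if ∀ v ∈ A, χ v = c then ((k : ℝ) ^ Fintype.card V)⁻¹ else 0) =
      ((k : ℝ) ^ A.card)⁻¹ := by
  have hk : (k : ℝ) ≠ 0 := by
    have := c.pos
    positivity
  have hset : (Finset.univ.filter fun χ : V → Fin k => ∀ v ∈ A, χ v = c) =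
      Fintype.piFinset fun v => if v ∈ A then {c} else Finset.univ := by
    ext χ
    simp only [mem_filter, Finset.mem_univ, true_and, Fintype.mem_piFinset]
    refine forall_congr' fun v => ?_
    split_ifs with h <;> simp [h]
  have hcard : (Finset.univ.filter fun χ : V → Fin k => ∀ v ∈ A, χ v = c).card * k ^ A.card =
      k ^ Fintype.card V := by
    rw [hset, Fintype.card_piFinset]
    have : ∀ v, (if v ∈ A then ({c} : Finset (Fin k)) else Finset.univ).card =
        if v ∈ A then 1 else k := by
      intro v
      split_ifs <;> simp
    simp only [this]
    have hA : ∏ v : V, (if v ∈ A then k else 1) = k ^ A.card := by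
      rw [Finset.prod_ite_mem, Finset.univ_inter, Finset.prod_const]
    rw [← hA, ← Finset.prod_mul_distrib, Fintype.card, ← Finset.prod_const]
    refine Finset.prod_congr rfl fun v _ => ?_
    split_ifs <;> simp
  rw [← Finset.sum_filter, Finset.sum_const, nsmul_eq_mul]
  have hcard' : ((_ : ℕ) : ℝ) = ((_ : ℕ) : ℝ) := congrArg Nat.cast hcard
  push_cast at hcard'
  field_simp
  linarith

/-- The probability that all edges of `T` are sampled and lie inside the part `c`. -/
lemma sum_sum_subset_partEdges [Fintype V] [DecidableEq V] (p : ℝ) (k : ℕ) (c : Fin k) {E T : Finset (Sym2 V)}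
    (hT : T ⊆ E) :
    ∑ S ∈ E.powerset, ∑ χ : V → Fin k, bwE p E S * ((k : ℝ) ^ Fintype.card V)⁻¹ *
        (if T ⊆ partEdges S (fun u => decide (χ u = c)) then 1 else 0) =
      p ^ T.card * ((k : ℝ) ^ (T.biUnion ends).card)⁻¹ := by
  rw [← sum_bwE_superset p hT, ← sum_coloring_eq k c, Finset.sum_mul_sum]
  refine Finset.sum_congr rfl fun S _ => Finset.sum_congr rfl fun χ _ => ?_
  have h : T ⊆ partEdges S (fun u => decide (χ u = c)) ↔
      T ⊆ S ∧ ∀ v ∈ T.biUnion ends, χ v = c := by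
    simp only [subset_iff, partEdges, ends, mem_filter, mem_biUnion, decide_eq_true_eq,
      Finset.mem_univ, true_and]
    constructor
    · exact fun h => ⟨fun e he => (h he).1, fun v ⟨e, he, hv⟩ => (h he).2 v hv⟩
    · exact fun h e he => ⟨h.1 he, fun v hv => h.2 v ⟨e, he, hv⟩⟩
  simp only [h, ite_and, mul_ite, mul_one, mul_zero, ite_mul, zero_mul]
  split_ifs <;> rfl

lemma card_ends [Fintype V] [DecidableEq V] {e : Sym2 V} (he : ¬ e.IsDiag) : (ends e).card = 2 := by
  induction e with
  | _ a b =>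
    rw [Sym2.mk_isDiag_iff] at he
    have : ends s(a, b) = {a, b} := by ext; simp [ends]
    rw [this, card_pair he]

lemma three_le_card_ends_union [Fintype V] [DecidableEq V] {e f : Sym2 V} (he : ¬ e.IsDiag) (hf : ¬ f.IsDiag)
    (hne : f ≠ e) : 3 ≤ (ends e ∪ ends f).card := by
  by_contra! h
  have h1 : ends e = ends e ∪ ends f :=
    eq_of_subset_of_card_le subset_union_left (by rw [card_ends he]; omega)
  have h2 : ends f = ends e ∪ ends f :=
    eq_of_subset_of_card_le subset_union_right (by rw [card_ends hf]; omega)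
  apply hne
  ext v
  have := congrArg (v ∈ ·) (h2.trans h1.symm)
  simpa [ends] using this

lemma card_edges_le [Fintype V] [DecidableEq V] {E : Finset (Sym2 V)} {Δ : ℕ}
    (hΔ : ∀ v : V, (E.filter fun e => v ∈ e).card ≤ Δ) : E.card ≤ Fintype.card V * Δ := by
  have h : E ⊆ Finset.univ.biUnion fun v : V => E.filter fun e => v ∈ e := by
    intro e he
    obtain ⟨v, hv⟩ := sym2_exists_mem e
    exact mem_biUnion.2 ⟨v, Finset.mem_univ v, mem_filter.2 ⟨he, hv⟩⟩
  exact (card_le_card h).trans (card_biUnion_le_card_mul _ _ _ fun v _ => hΔ v)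

lemma card_incident_le [Fintype V] [DecidableEq V] {E : Finset (Sym2 V)} {Δ : ℕ}
    (hΔ : ∀ v : V, (E.filter fun e => v ∈ e).card ≤ Δ) (e : Sym2 V) :
    (E.filter fun f => f ≠ e ∧ ∃ v, v ∈ e ∧ v ∈ f).card ≤ 2 * Δ := by
  induction e with
  | _ a b =>
    have h : (E.filter fun f => f ≠ s(a, b) ∧ ∃ v, v ∈ s(a, b) ∧ v ∈ f) ⊆
        (E.filter fun f => a ∈ f) ∪ E.filter fun f => b ∈ f := by
      intro f hf
      obtain ⟨hfE, -, v, hv, hvf⟩ := mem_filter.1 hf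
      rw [mem_union, mem_filter, mem_filter]
      rcases Sym2.mem_iff.1 hv with rfl | rfl
      · exact Or.inl ⟨hfE, hvf⟩
      · exact Or.inr ⟨hfE, hvf⟩
    have := (card_le_card h).trans (card_union_le _ _)
    have := hΔ a
    have := hΔ b
    omega

lemma sum_one_add_incident_eq [Fintype V] [DecidableEq V] {E S : Finset (Sym2 V)} (hS : S ⊆ E) (x : V → Bool) :
    ∑ e ∈ partEdges S x, (1 + ((E.filter fun f => Incident (partEdges S x) e f).card : ℝ) / 2) =
      ∑ e ∈ E, (if {e} ⊆ partEdges S x then 1 else 0) +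
      ∑ e ∈ E, ∑ f ∈ E with f ≠ e ∧ ∃ v, v ∈ e ∧ v ∈ f,
        (if {e, f} ⊆ partEdges S x then (1 : ℝ) else 0) / 2 := by
  have hH : E.filter (· ∈ partEdges S x) = partEdges S x := by
    ext e
    rw [mem_filter, and_iff_right_iff_imp]
    exact fun h => hS (mem_filter.1 h).1
  rw [← Finset.sum_add_distrib]
  conv_lhs => rw [← hH, Finset.sum_filter, hH]
  refine Finset.sum_congr rfl fun e _ => ?_
  simp only [singleton_subset_iff, insert_subset_iff]
  rw [← Finset.sum_div, ← Finset.sum_filter (fun f => e ∈ partEdges S x ∧ f ∈ partEdges S x),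
    filter_filter]
  split_ifs with he
  · simp only [Incident, he, true_and, Finset.sum_const, nsmul_eq_mul, mul_one]
    congr! 5
    tauto
  · simp [he]

/-- The expected number of edges, plus half the number of ordered pairs of incident edges, inside one
part. -/
lemma expected_incident_le [Fintype V] [DecidableEq V] (E : Finset (Sym2 V)) (hE : ∀ e ∈ E, ¬ e.IsDiag) (Δ : ℕ)
    (hΔ : ∀ v : V, (E.filter fun e => v ∈ e).card ≤ Δ) (p : ℝ) (hp : 0 ≤ p) (k : ℕ) (c : Fin k) :
    ∑ S ∈ E.powerset, ∑ χ : V → Fin k, bwE p E S * ((k : ℝ) ^ Fintype.card V)⁻¹ *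
        ∑ e ∈ partEdges S (fun u => decide (χ u = c)), (1 + ((E.filter fun f =>
          Incident (partEdges S (fun u => decide (χ u = c))) e f).card : ℝ) / 2) ≤
      Fintype.card V * (Δ * (p * ((k : ℝ) ^ 2)⁻¹) + Δ ^ 2 * (p ^ 2 * ((k : ℝ) ^ 3)⁻¹)) := by
  have hk : (1 : ℝ) ≤ k := by exact_mod_cast c.pos
  set w : Finset (Sym2 V) → ℝ := fun T =>
    ∑ S ∈ E.powerset, ∑ χ : V → Fin k, bwE p E S * ((k : ℝ) ^ Fintype.card V)⁻¹ *
        (if T ⊆ partEdges S (fun u => decide (χ u = c)) then 1 else 0) with hw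
  have h1 : ∀ e ∈ E, w {e} = p * ((k : ℝ) ^ 2)⁻¹ := by
    intro e he
    simp only [hw]
    rw [sum_sum_subset_partEdges p k c (singleton_subset_iff.2 he), card_singleton, pow_one,
      singleton_biUnion, card_ends (hE e he)]
  have h2 : ∀ e ∈ E, ∀ f ∈ E.filter (fun f => f ≠ e ∧ ∃ v, v ∈ e ∧ v ∈ f),
      w {e, f} ≤ p ^ 2 * ((k : ℝ) ^ 3)⁻¹ := by
    intro e he f hf
    obtain ⟨hfE, hne, -⟩ := mem_filter.1 hf
    simp only [hw]
    rw [sum_sum_subset_partEdges p k c (insert_subset he (singleton_subset_iff.2 hfE)),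
      card_pair hne.symm, biUnion_insert, singleton_biUnion]
    have := three_le_card_ends_union (hE e he) (hE f hfE) hne
    gcongr
  have hsplit : ∑ S ∈ E.powerset, ∑ χ : V → Fin k, bwE p E S * ((k : ℝ) ^ Fintype.card V)⁻¹ *
        ∑ e ∈ partEdges S (fun u => decide (χ u = c)), (1 + ((E.filter fun f =>
          Incident (partEdges S (fun u => decide (χ u = c))) e f).card : ℝ) / 2) =
      ∑ e ∈ E, w {e} + ∑ e ∈ E, ∑ f ∈ E with f ≠ e ∧ ∃ v, v ∈ e ∧ v ∈ f, w {e, f} / 2 := by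
    have h3 : ∑ e ∈ E, w {e} = ∑ S ∈ E.powerset, ∑ χ : V → Fin k,
        bwE p E S * ((k : ℝ) ^ Fintype.card V)⁻¹ * ∑ e ∈ E,
          (if {e} ⊆ partEdges S (fun u => decide (χ u = c)) then 1 else 0) := by
      simp only [hw, Finset.mul_sum]
      rw [Finset.sum_comm]
      exact Finset.sum_congr rfl fun S _ => Finset.sum_comm
    have h4 : ∑ e ∈ E, ∑ f ∈ E with f ≠ e ∧ ∃ v, v ∈ e ∧ v ∈ f, w {e, f} / 2 =
        ∑ S ∈ E.powerset, ∑ χ : V → Fin k, bwE p E S * ((k : ℝ) ^ Fintype.card V)⁻¹ *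
          ∑ e ∈ E, ∑ f ∈ E with f ≠ e ∧ ∃ v, v ∈ e ∧ v ∈ f,
            (if {e, f} ⊆ partEdges S (fun u => decide (χ u = c)) then (1 : ℝ) else 0) / 2 := by
      simp only [hw, Finset.mul_sum, Finset.sum_div, mul_div_assoc]
      rw [Finset.sum_sigma', Finset.sum_comm]
      refine Finset.sum_congr rfl fun S _ => ?_
      rw [Finset.sum_comm]
      exact Finset.sum_congr rfl fun χ _ => by rw [Finset.sum_sigma']
    rw [h3, h4, ← Finset.sum_add_distrib]
    refine Finset.sum_congr rfl fun S hS => ?_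
    rw [← Finset.sum_add_distrib]
    refine Finset.sum_congr rfl fun χ _ => ?_
    rw [sum_one_add_incident_eq (mem_powerset.1 hS), mul_add]
  have hm : (E.card : ℝ) ≤ Fintype.card V * Δ := by exact_mod_cast card_edges_le hΔ
  have hpair : ∀ e ∈ E, ∑ f ∈ E with f ≠ e ∧ ∃ v, v ∈ e ∧ v ∈ f, w {e, f} / 2 ≤
      Δ * (p ^ 2 * ((k : ℝ) ^ 3)⁻¹) := by
    intro e he
    rw [← Finset.sum_div]
    have h5 := Finset.sum_le_card_nsmul _ _ _ (h2 e he)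
    rw [nsmul_eq_mul] at h5
    have h6 : ((E.filter fun f => f ≠ e ∧ ∃ v, v ∈ e ∧ v ∈ f).card : ℝ) ≤ 2 * Δ := by
      exact_mod_cast card_incident_le hΔ e
    have h7 : (0 : ℝ) ≤ p ^ 2 * ((k : ℝ) ^ 3)⁻¹ := by positivity
    linarith [mul_le_mul_of_nonneg_right h6 h7]
  rw [hsplit, Finset.sum_congr rfl h1, Finset.sum_const, nsmul_eq_mul]
  have h8 := Finset.sum_le_card_nsmul _ _ _ hpair
  rw [nsmul_eq_mul] at h8
  have h9 : (0 : ℝ) ≤ p * ((k : ℝ) ^ 2)⁻¹ := by positivity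
  have h10 : (0 : ℝ) ≤ Δ * (p ^ 2 * ((k : ℝ) ^ 3)⁻¹) := by positivity
  linarith [mul_le_mul_of_nonneg_right hm h9, mul_le_mul_of_nonneg_right hm h10]

lemma bwE_nonneg {p : ℝ} (hp0 : 0 ≤ p) (hp1 : p ≤ 1) (E S : Finset (Sym2 V)) :
    0 ≤ bwE p E S :=
  mul_nonneg (pow_nonneg hp0 _) (pow_nonneg (sub_nonneg.2 hp1) _)

end Expectation

universe u

/-- **Expected total query cost over `L₁` is linear** (Claim 4.5).
There is a universal constant `C > 0` such that the following holds.  Run Algorithm 1 on an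
`n`-vertex graph `G = (V, E)` with maximum degree `Δ` (edge-sampling probability
`p = Δ^{-0.85}`, `k = Δ^{0.1}` parts).  Then `E[ ∑_{e ∈ L₁} A(e) ] ≤ C·n`, where the
expectation is over the permutation `π` (uniform over orderings of `E`), the edge sample
`L` (Bernoulli-`p` product over subsets `S ⊆ E`), and the vertex partition `χ` (uniform
over `V → Fin k`); `L₁` is the set of edges of `L` with both endpoints in `V₁`, and `A(e)`
is the number of edges of `L₁` on which `EdgeOracle_π` is (recursively) called during the
execution of `EdgeOracle_π(e, x⃗)`, `x⃗` being the indicator vector of `V₁`. -/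
theorem expected_L1_oracle_cost_linear :
    ∃ C : ℝ, 0 < C ∧
      ∀ (V : Type u) [Fintype V] [DecidableEq V]
        (E : Finset (Sym2 V)) (_ : ∀ e ∈ E, ¬ e.IsDiag)
        (Δ : ℕ) (_ : ∀ v : V, (E.filter fun e => v ∈ e).card ≤ Δ) (_ : 1 ≤ Δ)
        (p : ℝ) (_ : p = (Δ : ℝ) ^ (-(0.85 : ℝ)))
        (k : ℕ) (_ : (k : ℝ) = (Δ : ℝ) ^ ((0.1 : ℝ))) (hk0 : 0 < k),
        (∑ τ : Equiv.Perm (Fin E.card), ∑ S ∈ E.powerset, ∑ χ : V → Fin k,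
            bwE p E S * ((k : ℝ) ^ Fintype.card V)⁻¹ *
              ∑ e ∈ partEdges S (fun u => decide (χ u = ⟨0, hk0⟩)),
                ((edgeOracle (prioOf E τ) S (fun u => decide (χ u = ⟨0, hk0⟩)) e).2.2 : ℝ)) /
          (Fintype.card (Equiv.Perm (Fin E.card)) : ℝ) ≤ C * Fintype.card V := by
  refine ⟨2, two_pos, ?_⟩
  intro V _ _ E hE Δ hΔ hΔ1 p hp k hk hk0
  have hΔ1' : (1 : ℝ) ≤ Δ := by exact_mod_cast hΔ1
  have hΔ0 : (0 : ℝ) < Δ := by linarith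
  have hp0 : 0 ≤ p := hp ▸ Real.rpow_nonneg hΔ0.le _
  have hp1 : p ≤ 1 := hp ▸ Real.rpow_le_one_of_one_le_of_nonpos hΔ1' (by norm_num)
  set c : Fin k := ⟨0, hk0⟩
  have hN : (0 : ℝ) < E.card.factorial := by positivity
  rw [Fintype.card_perm, Fintype.card_fin, div_le_iff₀ hN]
  have hedges : Δ * (p * ((k : ℝ) ^ 2)⁻¹) ≤ 1 := by
    have h : (Δ : ℝ) * (p * ((k : ℝ) ^ 2)⁻¹) = (Δ : ℝ) ^ (-(0.05 : ℝ)) := by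
      rw [hp, hk, ← Real.rpow_natCast, ← Real.rpow_mul hΔ0.le, ← Real.rpow_neg hΔ0.le,
        ← Real.rpow_add hΔ0]
      nth_rewrite 1 [← Real.rpow_one (Δ : ℝ)]
      rw [← Real.rpow_add hΔ0]
      norm_num
    rw [h]
    exact Real.rpow_le_one_of_one_le_of_nonpos hΔ1' (by norm_num)
  have hpairs : Δ ^ 2 * (p ^ 2 * ((k : ℝ) ^ 3)⁻¹) = 1 := by
    rw [hp, hk, ← Real.rpow_natCast, ← Real.rpow_natCast, ← Real.rpow_natCast,
      ← Real.rpow_mul hΔ0.le, ← Real.rpow_mul hΔ0.le, ← Real.rpow_neg hΔ0.le,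
      ← Real.rpow_add hΔ0, ← Real.rpow_add hΔ0]
    norm_num
  calc _ = ∑ S ∈ E.powerset, ∑ χ : V → Fin k, bwE p E S * ((k : ℝ) ^ Fintype.card V)⁻¹ *
        ∑ τ : Equiv.Perm (Fin E.card), ∑ e ∈ partEdges S (fun u => decide (χ u = c)),
          ((edgeOracle (prioOf E τ) S (fun u => decide (χ u = c)) e).2.2 : ℝ) := by
        rw [Finset.sum_comm]
        refine Finset.sum_congr rfl fun S _ => ?_
        rw [Finset.sum_comm]
        exact Finset.sum_congr rfl fun χ _ => (Finset.mul_sum _ _ _).symm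
    _ ≤ ∑ S ∈ E.powerset, ∑ χ : V → Fin k, bwE p E S * ((k : ℝ) ^ Fintype.card V)⁻¹ *
        (E.card.factorial * ∑ e ∈ partEdges S (fun u => decide (χ u = c)), (1 + ((E.filter fun f =>
          Incident (partEdges S (fun u => decide (χ u = c))) e f).card : ℝ) / 2)) := by
        refine Finset.sum_le_sum fun S hS => Finset.sum_le_sum fun χ _ => ?_
        exact mul_le_mul_of_nonneg_left
          (sum_sum_edgeOracle_le E S (mem_powerset.1 hS) _)
          (mul_nonneg (bwE_nonneg hp0 hp1 E S) (by positivity))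
    _ = E.card.factorial * ∑ S ∈ E.powerset, ∑ χ : V → Fin k,
        bwE p E S * ((k : ℝ) ^ Fintype.card V)⁻¹ *
        ∑ e ∈ partEdges S (fun u => decide (χ u = c)), (1 + ((E.filter fun f =>
          Incident (partEdges S (fun u => decide (χ u = c))) e f).card : ℝ) / 2) := by
        simp only [Finset.mul_sum (a := (E.card.factorial : ℝ)), mul_left_comm]
    _ ≤ E.card.factorial * (Fintype.card V * 2) := by
        refine mul_le_mul_of_nonneg_left ?_ hN.le
        refine (expected_incident_le E hE Δ hΔ p hp0 k c).trans ?_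
        exact mul_le_mul_of_nonneg_left (by linarith) (Nat.cast_nonneg _)
    _ = _ := by ring
end
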